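/- Let 0 < μ₁ ≤ μ₂ with μ₁ + μ₂ = 1, E < 0, L > 0, and E·L² < σ(μ₁,μ₂). Then the set I_π = { (δL, δE) ∈ ℝ² : 1 + 2E₁L₁² ≥ 0, 1 + 2E₂L₂² ≥ 0, and √(1 + 2E₁L₁²)·√(1 + 2E₂L₂²) ≥ −(1 + L₂²E₁ + L₁²E₂) }, where E₁ = E + μ₂δE, E₂ = E − μ₁δE, L₁ = L + μ₂δL, L₂ = L − μ₁δL, is a compact subset of ℝ², and every point of I_π satisfies E₁ < 0 and E₂ < 0. -/

import Mathlib

/-- The critical eccentricity `e = (√((μ₁/μ₂)⁴ + 8(μ₁/μ₂)²) − (μ₁/μ₂)²)/4`. -/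
noncomputable def eCrit (μ₁ μ₂ : ℝ) : ℝ :=
  (Real.sqrt ((μ₁ / μ₂) ^ 4 + 8 * (μ₁ / μ₂) ^ 2) - (μ₁ / μ₂) ^ 2) / 4

/-- The critical constant `σ(μ₁,μ₂) = −(1−e²)(μ₁² + μ₂²e)²/(2μ₂e²)`. -/
noncomputable def sigma (μ₁ μ₂ : ℝ) : ℝ :=
  -((1 - (eCrit μ₁ μ₂) ^ 2) * (μ₁ ^ 2 + μ₂ ^ 2 * eCrit μ₁ μ₂) ^ 2) /
    (2 * μ₂ * (eCrit μ₁ μ₂) ^ 2)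

/-- The set `I_π` of parameter pairs `(δL, δE)` of admissible co-focal orbits
which intersect when the periapsides are in opposition. -/
def Ipi (μ₁ μ₂ E L : ℝ) : Set (ℝ × ℝ) :=
  {p : ℝ × ℝ |
    1 + 2 * (E + μ₂ * p.2) * (L + μ₂ * p.1) ^ 2 ≥ 0 ∧
    1 + 2 * (E - μ₁ * p.2) * (L - μ₁ * p.1) ^ 2 ≥ 0 ∧
    Real.sqrt (1 + 2 * (E + μ₂ * p.2) * (L + μ₂ * p.1) ^ 2) *
        Real.sqrt (1 + 2 * (E - μ₁ * p.2) * (L - μ₁ * p.1) ^ 2) ≥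
      -(1 + (L - μ₁ * p.1) ^ 2 * (E + μ₂ * p.2) + (L + μ₂ * p.1) ^ 2 * (E - μ₁ * p.2))}

lemma eCrit_spec {μ₁ μ₂ : ℝ} (h₁ : 0 < μ₁) (h₂ : 0 < μ₂) :
    0 < eCrit μ₁ μ₂ ∧ eCrit μ₁ μ₂ < 1 ∧
      (μ₁ / μ₂) ^ 2 * (1 - eCrit μ₁ μ₂) = 2 * eCrit μ₁ μ₂ ^ 2 := by
  have hm : 0 < (μ₁ / μ₂) ^ 2 := by positivity
  have hr := Real.sq_sqrt (show 0 ≤ (μ₁ / μ₂) ^ 4 + 8 * (μ₁ / μ₂) ^ 2 by positivity)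
  have hr0 := Real.sqrt_nonneg ((μ₁ / μ₂) ^ 4 + 8 * (μ₁ / μ₂) ^ 2)
  unfold eCrit
  set r := Real.sqrt ((μ₁ / μ₂) ^ 4 + 8 * (μ₁ / μ₂) ^ 2)
  set n := (μ₁ / μ₂) ^ 2
  have hr' : r ^ 2 = n ^ 2 + 8 * n := by rw [hr]; ring
  refine ⟨?_, ?_, ?_⟩
  · have : n < r := by nlinarith
    linarith
  · have : r < n + 4 := by nlinarith
    linarith
  · linear_combination -(1 / 8 : ℝ) * hr'

lemma sigma_eq {μ₁ μ₂ : ℝ} (h₁ : 0 < μ₁) (h₂ : 0 < μ₂) :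
    -2 * sigma μ₁ μ₂ = μ₂ ^ 3 * ((1 + eCrit μ₁ μ₂) ^ 3 / (1 - eCrit μ₁ μ₂)) := by
  obtain ⟨he0, he1, he⟩ := eCrit_spec h₁ h₂
  unfold sigma
  set e := eCrit μ₁ μ₂
  have h1e : 1 - e ≠ 0 := by linarith
  have hsq : μ₁ ^ 2 = μ₂ ^ 2 * (2 * e ^ 2 / (1 - e)) := by
    field_simp at he ⊢
    linarith
  rw [hsq]
  field_simp
  ring

/-- The product `(2 - s²)(m√2 + s)²` is the value of `-2EL²` when one orbit is a parabola whose
periapsis touches the apoapsis of an ellipse of eccentricity `1 - s²`. -/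
lemma tangent_parabola_le {m e s : ℝ} (hm : 0 < m) (he0 : 0 < e) (he1 : e < 1)
    (he : m ^ 2 * (1 - e) = 2 * e ^ 2) (hs : s ^ 2 ≤ 2) :
    (2 - s ^ 2) * (m * √2 + s) ^ 2 ≤ (1 + e) ^ 3 / (1 - e) := by
  have h1e : 0 < 1 - e := by linarith
  set S := √(1 - e)
  have hS : 0 < S := Real.sqrt_pos.2 h1e
  have hSS : S ^ 2 = 1 - e := Real.sq_sqrt h1e.le
  set k := m * √2
  have hk : 0 < k := by positivity
  have hkS : k * S = 2 * e := by
    have h : (k * S) ^ 2 = (2 * e) ^ 2 := by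
      simp only [k, mul_pow, hSS, Real.sq_sqrt (show (0 : ℝ) ≤ 2 by norm_num)]
      linear_combination 2 * he
    exact (pow_left_inj₀ (by positivity) (by positivity) two_ne_zero).1 h
  have h1 : (k + s) ^ 2 * (1 - e) ≤ (2 * e + s ^ 2) * (1 + e) := by
    have : (2 * e + s ^ 2) * (1 + e) - (k + s) ^ 2 * (1 - e) = k * S * (S - s) ^ 2 := by
      linear_combination (-(S - s) ^ 2 - (k * S + 2 * e) - 2 * s * S) * hkS +
        (k ^ 2 + 2 * k * s - 2 * e) * hSS
    have := mul_nonneg (mul_nonneg hk.le hS.le) (sq_nonneg (S - s))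
    linarith
  have h2 : (2 - s ^ 2) * (2 * e + s ^ 2) ≤ (1 + e) ^ 2 := by
    nlinarith [sq_nonneg (s ^ 2 - (1 - e))]
  rw [le_div_iff₀ h1e]
  calc (2 - s ^ 2) * (k + s) ^ 2 * (1 - e) = (2 - s ^ 2) * ((k + s) ^ 2 * (1 - e)) := by ring
    _ ≤ (2 - s ^ 2) * ((2 * e + s ^ 2) * (1 + e)) :=
        mul_le_mul_of_nonneg_left h1 (by linarith)
    _ = (2 - s ^ 2) * (2 * e + s ^ 2) * (1 + e) := by ring
    _ ≤ (1 + e) ^ 2 * (1 + e) := mul_le_mul_of_nonneg_right h2 (by linarith)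
    _ = (1 + e) ^ 3 := by ring

lemma tangent_hyperbola_le {m A s t : ℝ} (hm : 0 < m)
    (hA : ∀ s : ℝ, 0 ≤ s → s ^ 2 ≤ 2 → (2 - s ^ 2) * (m * √2 + s) ^ 2 ≤ A)
    (ht : √2 ≤ t) :
    (2 - s ^ 2 - m * (t ^ 2 - 2)) * (m * t + s) ^ 2 ≤ A := by
  have h2 : √2 ^ 2 = (2 : ℝ) := Real.sq_sqrt (by norm_num)
  have h20 : 0 ≤ √2 := Real.sqrt_nonneg 2
  have ht2 : 2 ≤ t ^ 2 := by nlinarith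
  have hn : 0 ≤ m * (t ^ 2 - 2) := mul_nonneg hm.le (by linarith)
  set s₀ := √(s ^ 2 + m * (t ^ 2 - 2))
  have hs₀ : 0 ≤ s₀ := Real.sqrt_nonneg _
  have hss : s₀ ^ 2 = s ^ 2 + m * (t ^ 2 - 2) := Real.sq_sqrt (by positivity)
  rcases le_or_gt (s₀ ^ 2) 2 with h | h
  · refine le_trans ?_ (hA s₀ hs₀ h)
    have hle : s ≤ s₀ := by nlinarith
    have hs₀2 : s₀ ≤ √2 := by nlinarith
    have hd : (√2 - s₀) ^ 2 ≤ (t - s) ^ 2 :=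
      pow_le_pow_left₀ (by linarith) (by linarith) 2
    have key : (m * t + s) ^ 2 ≤ (m * √2 + s₀) ^ 2 := by
      have hid : (m * √2 + s₀) ^ 2 - (m * t + s) ^ 2 =
          m * ((t - s) ^ 2 - (√2 - s₀) ^ 2) := by
        linear_combination (m ^ 2 + m) * h2 + (1 + m) * hss
      have := mul_nonneg hm.le (sub_nonneg.2 hd)
      linarith
    have : 2 - s ^ 2 - m * (t ^ 2 - 2) = 2 - s₀ ^ 2 := by linarith
    rw [this]
    exact mul_le_mul_of_nonneg_left key (by linarith)
  · have h0 := hA 0 le_rfl (by norm_num)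
    have : (2 - s ^ 2 - m * (t ^ 2 - 2)) * (m * t + s) ^ 2 ≤ 0 :=
      mul_nonpos_of_nonpos_of_nonneg (by linarith) (sq_nonneg _)
    have : 0 ≤ (2 - (0 : ℝ) ^ 2) * (m * √2 + 0) ^ 2 := by positivity
    linarith

/-- The periapsis of the first orbit does not exceed the apoapsis of the second one. -/
lemma periapsis_le_apoapsis {x y a b : ℝ}
    (hx : 0 ≤ 1 + 2 * x * a ^ 2) (hy : 0 ≤ 1 + 2 * y * b ^ 2) (hy0 : y < 0)
    (h : √(1 + 2 * x * a ^ 2) * √(1 + 2 * y * b ^ 2) ≥ -(1 + b ^ 2 * x + a ^ 2 * y)) :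
    -2 * y * a ^ 2 ≤ (1 + √(1 + 2 * y * b ^ 2)) * (1 + √(1 + 2 * x * a ^ 2)) := by
  have hf := Real.sq_sqrt hx
  have hq := Real.sq_sqrt hy
  have hf0 := Real.sqrt_nonneg (1 + 2 * x * a ^ 2)
  have hq0 := Real.sqrt_nonneg (1 + 2 * y * b ^ 2)
  set f := √(1 + 2 * x * a ^ 2)
  set q := √(1 + 2 * y * b ^ 2)
  have hmul : 0 ≤ 2 * (-2 * y * a ^ 2) * (f * q + 1 + b ^ 2 * x + a ^ 2 * y) :=
    mul_nonneg (by nlinarith [sq_nonneg a]) (by linarith)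
  have hsq : (-2 * y * a ^ 2 - (1 + f * q)) ^ 2 ≤ (f + q) ^ 2 := by
    have : (f + q) ^ 2 - (-2 * y * a ^ 2 - (1 + f * q)) ^ 2 =
        2 * (-2 * y * a ^ 2) * (f * q + 1 + b ^ 2 * x + a ^ 2 * y) := by
      linear_combination (1 - q ^ 2) * hf - (2 * x * a ^ 2) * hq
    linarith
  have := abs_le_of_sq_le_sq hsq (by positivity)
  linarith [le_abs_self (-2 * y * a ^ 2 - (1 + f * q))]

lemma energy_momentum_le {m A x y a b : ℝ} (hm : 0 < m)
    (hA : ∀ s : ℝ, 0 ≤ s → s ^ 2 ≤ 2 → (2 - s ^ 2) * (m * √2 + s) ^ 2 ≤ A)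
    (ha : 0 ≤ a) (hb : 0 ≤ b) (hx0 : 0 ≤ x) (hy0 : y < 0) (hy : 0 ≤ 1 + 2 * y * b ^ 2)
    (h : √(1 + 2 * x * a ^ 2) * √(1 + 2 * y * b ^ 2) ≥ -(1 + b ^ 2 * x + a ^ 2 * y)) :
    -2 * (m * x + y) * (m * a + b) ^ 2 ≤ A := by
  have hx : 0 ≤ 1 + 2 * x * a ^ 2 := by positivity
  have hT := periapsis_le_apoapsis hx hy hy0 h
  have hf := Real.sq_sqrt hx
  have hq := Real.sq_sqrt hy
  have hf0 := Real.sqrt_nonneg (1 + 2 * x * a ^ 2)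
  have hq0 := Real.sqrt_nonneg (1 + 2 * y * b ^ 2)
  set f := √(1 + 2 * x * a ^ 2)
  set q := √(1 + 2 * y * b ^ 2)
  have hg2 : 0 < (1 + q) / (-2 * y) := div_pos (by linarith) (by linarith)
  set g := √((1 + q) / (-2 * y))
  have hg : 0 < g := Real.sqrt_pos.2 hg2
  have hgg : -2 * y * g ^ 2 = 1 + q := by
    rw [Real.sq_sqrt hg2.le, mul_div_cancel₀ _ (by linarith)]
  obtain ⟨t, hat⟩ : ∃ t, a = g * t := ⟨a / g, by field_simp⟩
  obtain ⟨s, hbs⟩ : ∃ s, b = g * s := ⟨b / g, by field_simp⟩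
  clear_value f q g
  subst hat hbs
  have ht : 0 ≤ t := nonneg_of_mul_nonneg_right ha hg
  have hs : 0 ≤ s := nonneg_of_mul_nonneg_right hb hg
  have hs2 : s ^ 2 = 1 - q := by
    have : (1 + q) * s ^ 2 = (1 + q) * (1 - q) := by
      linear_combination (-s ^ 2) * hgg + hq
    exact mul_left_cancel₀ (by linarith) this
  have htf : t ^ 2 ≤ 1 + f := by
    have : (1 + q) * t ^ 2 ≤ (1 + q) * (1 + f) := by
      calc (1 + q) * t ^ 2 = -2 * y * (g * t) ^ 2 := by rw [← hgg]; ring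
        _ ≤ _ := hT
    exact le_of_mul_le_mul_left this (by linarith)
  have hV : -2 * (m * x + y) * (m * (g * t) + g * s) ^ 2 =
      (2 - s ^ 2 - m * (2 * x * g ^ 2)) * (m * t + s) ^ 2 := by
    linear_combination (m * t + s) ^ 2 * (hgg + hs2)
  rw [hV]
  rcases le_total (√2) t with h2 | h2
  · refine le_trans ?_ (tangent_hyperbola_le (s := s) hm hA h2)
    have h22 : 2 ≤ t ^ 2 := by
      have := pow_le_pow_left₀ (Real.sqrt_nonneg 2) h2 2
      rwa [Real.sq_sqrt (by norm_num)] at this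
    have hX : t ^ 2 - 2 ≤ 2 * x * g ^ 2 := by
      have : t ^ 2 * (t ^ 2 - 2) ≤ t ^ 2 * (2 * x * g ^ 2) := by
        have : t ^ 2 * (2 * x * g ^ 2) = (f + 1) * (f - 1) := by linear_combination -hf
        rw [this]
        exact mul_le_mul (by linarith) (by linarith) (by linarith) (by linarith)
      exact le_of_mul_le_mul_left this (by linarith)
    have := mul_le_mul_of_nonneg_left hX hm.le
    exact mul_le_mul_of_nonneg_right (by linarith) (sq_nonneg _)
  · have hs2' : s ^ 2 ≤ 2 := by linarith
    refine le_trans ?_ (hA s hs hs2')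
    have h1 : 0 ≤ m * (2 * x * g ^ 2) := by positivity
    have h2' : (m * t + s) ^ 2 ≤ (m * √2 + s) ^ 2 := by gcongr
    calc _ ≤ (2 - s ^ 2) * (m * t + s) ^ 2 :=
          mul_le_mul_of_nonneg_right (by linarith) (sq_nonneg _)
      _ ≤ _ := mul_le_mul_of_nonneg_left h2' (by linarith)

/-- The bound for the swapped mass ratio `1 / m ≥ 1` follows from the one for `m`. -/
lemma swapped_tangent_parabola_le {m A s : ℝ} (hm : 0 < m) (hm1 : m ≤ 1)
    (hA : ∀ s : ℝ, 0 ≤ s → s ^ 2 ≤ 2 → (2 - s ^ 2) * (m * √2 + s) ^ 2 ≤ A)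
    (hs : s ^ 2 ≤ 2) :
    (2 - s ^ 2) * (m⁻¹ * √2 + s) ^ 2 ≤ A / m ^ 3 := by
  have h2 : √2 ^ 2 = (2 : ℝ) := Real.sq_sqrt (by norm_num)
  have hA' : 3 * (m + 1 / 2) ^ 2 ≤ A := by
    have := hA (√2 / 2) (by positivity) (by rw [div_pow, h2]; norm_num)
    have h : (2 - (√2 / 2) ^ 2) * (m * √2 + √2 / 2) ^ 2 = 3 * (m + 1 / 2) ^ 2 := by
      have h4 : (√2 / 2) ^ 2 = (1 / 2 : ℝ) := by rw [div_pow, h2]; norm_num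
      rw [h4]
      linear_combination (3 / 2 : ℝ) * (m + 1 / 2) ^ 2 * h2
    linarith
  rw [le_div_iff₀ (by positivity)]
  have hrw : (2 - s ^ 2) * (m⁻¹ * √2 + s) ^ 2 * m ^ 3 =
      m * (2 - s ^ 2) * (√2 + m * s) ^ 2 := by
    field_simp
  rw [hrw]
  have h1 : (√2 + m * s) ^ 2 ≤ (2 + m) * (1 + m * s ^ 2) := by
    nlinarith [mul_nonneg hm.le (sq_nonneg (1 - √2 * s))]
  have h3 : m * (2 - s ^ 2) * (1 + m * s ^ 2) ≤ (m + 1 / 2) ^ 2 := by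
    nlinarith [sq_nonneg (m * s ^ 2 - (m - 1 / 2))]
  calc m * (2 - s ^ 2) * (√2 + m * s) ^ 2
      ≤ m * (2 - s ^ 2) * ((2 + m) * (1 + m * s ^ 2)) :=
        mul_le_mul_of_nonneg_left h1 (mul_nonneg hm.le (by linarith))
    _ = (2 + m) * (m * (2 - s ^ 2) * (1 + m * s ^ 2)) := by ring
    _ ≤ (2 + m) * (m + 1 / 2) ^ 2 := mul_le_mul_of_nonneg_left h3 (by linarith)
    _ ≤ 3 * (m + 1 / 2) ^ 2 := mul_le_mul_of_nonneg_right (by linarith) (sq_nonneg _)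
    _ ≤ A := hA'

/-- If the orbit of weight `ν₁` is not elliptic, then the bound on intersecting orbits holds for
the weighted means. -/
lemma mean_energy_momentum_le {ν₁ ν₂ A x y l₁ l₂ L : ℝ} (h₁ : 0 < ν₁) (h₂ : 0 < ν₂)
    (hA : ∀ s : ℝ, 0 ≤ s → s ^ 2 ≤ 2 → (2 - s ^ 2) * (ν₁ / ν₂ * √2 + s) ^ 2 ≤ A)
    (hE : ν₁ * x + ν₂ * y < 0) (hL : 0 < L) (hLl : L = ν₁ * l₁ + ν₂ * l₂)
    (hx0 : 0 ≤ x) (hy : 0 ≤ 1 + 2 * y * l₂ ^ 2)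
    (h : √(1 + 2 * x * l₁ ^ 2) * √(1 + 2 * y * l₂ ^ 2) ≥ -(1 + l₂ ^ 2 * x + l₁ ^ 2 * y)) :
    -2 * ((ν₁ * x + ν₂ * y) * L ^ 2) ≤ ν₂ ^ 3 * A := by
  have hy0 : y < 0 := by
    by_contra! hc
    have := add_nonneg (mul_nonneg h₁.le hx0) (mul_nonneg h₂.le hc)
    linarith
  have key := energy_momentum_le (a := |l₁|) (b := |l₂|) (div_pos h₁ h₂) hA
    (abs_nonneg _) (abs_nonneg _) hx0 hy0 (by rwa [sq_abs]) (by simpa only [sq_abs] using h)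
  have hLle : L ≤ ν₁ * |l₁| + ν₂ * |l₂| := by
    rw [hLl]
    gcongr <;> exact le_abs_self _
  have hsq : L ^ 2 ≤ (ν₁ * |l₁| + ν₂ * |l₂|) ^ 2 := by gcongr
  have hmul := mul_le_mul_of_nonneg_left hsq (show 0 ≤ -2 * (ν₁ * x + ν₂ * y) by linarith)
  have hrw : -2 * (ν₁ * x + ν₂ * y) * (ν₁ * |l₁| + ν₂ * |l₂|) ^ 2 =
      ν₂ ^ 3 * (-2 * (ν₁ / ν₂ * x + y) * (ν₁ / ν₂ * |l₁| + |l₂|) ^ 2) := by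
    field_simp
  have := mul_le_mul_of_nonneg_left key (show 0 ≤ ν₂ ^ 3 by positivity)
  linarith

lemma Ipi_elliptic {μ₁ μ₂ E L : ℝ}
    (hμ₁ : 0 < μ₁) (hμ₁₂ : μ₁ ≤ μ₂) (hsum : μ₁ + μ₂ = 1)
    (hE : E < 0) (hL : 0 < L) (hσ : E * L ^ 2 < sigma μ₁ μ₂)
    {p : ℝ × ℝ} (hp : p ∈ Ipi μ₁ μ₂ E L) : E + μ₂ * p.2 < 0 ∧ E - μ₁ * p.2 < 0 := by
  obtain ⟨h1, h2, h3⟩ := hp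
  have hμ₂ : 0 < μ₂ := hμ₁.trans_le hμ₁₂
  have hm : 0 < μ₁ / μ₂ := div_pos hμ₁ hμ₂
  have hm1 : μ₁ / μ₂ ≤ 1 := (div_le_one hμ₂).2 hμ₁₂
  obtain ⟨he0, he1, he⟩ := eCrit_spec hμ₁ hμ₂
  have hσ' := sigma_eq hμ₁ hμ₂
  set A := (1 + eCrit μ₁ μ₂) ^ 3 / (1 - eCrit μ₁ μ₂)
  have hA : ∀ s : ℝ, 0 ≤ s → s ^ 2 ≤ 2 → (2 - s ^ 2) * (μ₁ / μ₂ * √2 + s) ^ 2 ≤ A :=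
    fun s _ hs => tangent_parabola_le hm he0 he1 he hs
  have hA' : ∀ s : ℝ, 0 ≤ s → s ^ 2 ≤ 2 →
      (2 - s ^ 2) * (μ₂ / μ₁ * √2 + s) ^ 2 ≤ A / (μ₁ / μ₂) ^ 3 := fun s _ hs => by
    have := swapped_tangent_parabola_le hm hm1 hA hs
    rwa [inv_div] at this
  have hE' : μ₁ * (E + μ₂ * p.2) + μ₂ * (E - μ₁ * p.2) = E := by linear_combination E * hsum
  have hL' : L = μ₁ * (L + μ₂ * p.1) + μ₂ * (L - μ₁ * p.1) := by linear_combination -L * hsum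
  constructor <;> by_contra! hc
  · have := mean_energy_momentum_le hμ₁ hμ₂ hA (by rwa [hE']) hL hL' hc h2 h3
    rw [hE'] at this
    linarith
  · have := mean_energy_momentum_le hμ₂ hμ₁ hA' (by rwa [add_comm, hE']) hL
      (by rw [add_comm]; exact hL') hc h1 (by rw [mul_comm]; linarith)
    rw [add_comm, hE'] at this
    have hrw : μ₁ ^ 3 * (A / (μ₁ / μ₂) ^ 3) = μ₂ ^ 3 * A := by field_simp
    linarith

lemma isClosed_Ipi (μ₁ μ₂ E L : ℝ) : IsClosed (Ipi μ₁ μ₂ E L) := by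
  simp only [Ipi, ge_iff_le, Set.ofPred_and]
  refine (isClosed_le ?_ ?_).inter ((isClosed_le ?_ ?_).inter (isClosed_le ?_ ?_)) <;> fun_prop

/-- An elliptic orbit whose energy is at most `E < 0` has angular momentum at most `1 - E⁻¹`. -/
lemma abs_momentum_le {E x l : ℝ} (hE : E < 0) (hx : x ≤ E) (h : 0 ≤ 1 + 2 * x * l ^ 2) :
    |l| ≤ 1 - E⁻¹ := by
  have h1 : 0 ≤ 1 + 2 * E * l ^ 2 := by nlinarith [sq_nonneg l]
  have h2 : l ^ 2 ≤ -E⁻¹ := by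
    rw [← inv_neg, ← one_div, le_div_iff₀ (by linarith)]
    nlinarith [sq_nonneg l]
  rw [← sq_abs] at h2
  nlinarith [sq_nonneg (|l| - 1), abs_nonneg l]

lemma isBounded_Ipi_of_elliptic {μ₁ μ₂ E L : ℝ} (hμ₁ : 0 < μ₁) (hμ₂ : 0 < μ₂) (hE : E < 0)
    (hell : ∀ p ∈ Ipi μ₁ μ₂ E L, E + μ₂ * p.2 < 0 ∧ E - μ₁ * p.2 < 0) :
    Bornology.IsBounded (Ipi μ₁ μ₂ E L) := by
  set M := |L| + (1 - E⁻¹)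
  have hM : 0 ≤ M := by
    have := inv_lt_zero.2 hE
    have := abs_nonneg L
    simp only [M]
    linarith
  refine (Metric.isBounded_Icc (-(M / μ₁ + M / μ₂), E / μ₁)
    (M / μ₁ + M / μ₂, -E / μ₂)).subset fun p hp => ?_
  obtain ⟨h1, h2⟩ := hell p hp
  obtain ⟨g1, g2, -⟩ := hp
  have key : |p.1| ≤ M / μ₁ + M / μ₂ := by
    rcases le_total p.2 0 with hs | hs
    · have hl := abs_momentum_le hE (by nlinarith) g1
      have h : |μ₂ * p.1| ≤ M := by
        have := abs_sub (L + μ₂ * p.1) L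
        rw [add_sub_cancel_left] at this
        simp only [M]
        linarith
      rw [abs_mul, abs_of_pos hμ₂, mul_comm, ← le_div_iff₀ hμ₂] at h
      exact h.trans (le_add_of_nonneg_left (by positivity))
    · have hl := abs_momentum_le hE (by nlinarith) g2
      have h : |μ₁ * p.1| ≤ M := by
        have := abs_sub L (L - μ₁ * p.1)
        rw [sub_sub_cancel] at this
        simp only [M]
        linarith
      rw [abs_mul, abs_of_pos hμ₁, mul_comm, ← le_div_iff₀ hμ₁] at h
      exact h.trans (le_add_of_nonneg_right (by positivity))
  refine ⟨⟨(abs_le.1 key).1, ?_⟩, ⟨(abs_le.1 key).2, ?_⟩⟩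
  · change E / μ₁ ≤ p.2
    rw [div_le_iff₀ hμ₁]
    linarith
  · change p.2 ≤ -E / μ₂
    rw [le_div_iff₀ hμ₂]
    linarith

theorem Ipi_compact_and_elliptic
    (μ₁ μ₂ E L : ℝ)
    (hμ₁ : 0 < μ₁) (hμ₁₂ : μ₁ ≤ μ₂) (hsum : μ₁ + μ₂ = 1)
    (hE : E < 0) (hL : 0 < L) (hσ : E * L ^ 2 < sigma μ₁ μ₂) :
    IsCompact (Ipi μ₁ μ₂ E L) ∧
      ∀ p ∈ Ipi μ₁ μ₂ E L, E + μ₂ * p.2 < 0 ∧ E - μ₁ * p.2 < 0 := by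
  have hell : ∀ p ∈ Ipi μ₁ μ₂ E L, E + μ₂ * p.2 < 0 ∧ E - μ₁ * p.2 < 0 :=
    fun p hp => Ipi_elliptic hμ₁ hμ₁₂ hsum hE hL hσ hp
  exact ⟨Metric.isCompact_of_isClosed_isBounded (isClosed_Ipi μ₁ μ₂ E L)
    (isBounded_Ipi_of_elliptic hμ₁ (hμ₁.trans_le hμ₁₂) hE hell), hell⟩
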